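/- arXiv:2406.09748 — 5 statements merged into one kernel-verified Lean document; each statement's English description precedes it below -/
import Mathlib

section
/- Let X be a compact metrizable topological space, let Δ be a weak-*-closed set of Borel probability measures on X, and let ω be a free ultrafilter on ℕ. Then the following are equivalent. (A) [approximate divisibility] There is K > 0 such that for every n ∈ ℕ there exist, for i = 1, ..., n, sequences (p_{i,k})_{k∈ℕ} of continuous functions X → [0,1] with: lim_{k→ω} sup_{μ∈Δ} ∫ (p_{i,k} p_{j,k})² dμ = 0 for all i ≠ j; lim_{k→ω} sup_{μ∈Δ} ∫ (p_{i,k} − p_{i,k}²)² dμ = 0 for all i; lim_{k→ω} sup_{μ∈Δ} ∫ (1 − (p_{1,k} + ... + p_{n,k}))² dμ = 0; and for every i, every continuous f : X → [0,∞), and every sequence (μ_k) in Δ: lim_{k→ω} ∫ p_{i,k}² f dμ_k ≤ (K/n) · lim_{k→ω} ∫ f dμ_k. (B) There is K > 0 such that for every finite set F of continuous functions X → [0,∞), every ε > 0, and every n ∈ ℕ, there exist continuous functions p_1, ..., p_n : X → [0,1] such that: (1) ‖p_i p_j‖_{2,Δ} < ε for i ≠ j; (2) ‖p_i − p_i²‖_{2,Δ}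 < ε for each i; (3) ‖1 − (p_1² + ... + p_n²)‖_{2,Δ} < ε; (4) ∫ p_i² f dμ < (K/n) ∫ f dμ + ε for each i, each f ∈ F, and each μ ∈ Δ. -/
open MeasureTheory Filter Topology
open scoped NNReal ENNReal

/-- The uniform 2-seminorm `‖h‖_{2,Δ} = sup_{μ ∈ Δ} (∫ |h|² dμ)^{1/2}`. -/
noncomputable def uniformTraceNorm {X : Type*} [TopologicalSpace X] [MeasurableSpace X]
    (Δ : Set (ProbabilityMeasure X)) (h : C(X, ℝ)) : ℝ :=
  ⨆ μ ∈ Δ, Real.sqrt (∫ x, (h x) ^ 2 ∂(μ : Measure X))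

theorem biSup_le_of_nonneg {ι : Type*} {s : Set ι} {g : ι → ℝ} {c : ℝ} (hc : 0 ≤ c)
    (h : ∀ i ∈ s, g i ≤ c) : ⨆ i ∈ s, g i ≤ c :=
  Real.iSup_le (fun i => Real.iSup_le (h i) hc) hc

theorem le_biSup_of_forall_le {ι : Type*} {s : Set ι} {g : ι → ℝ} {C : ℝ}
    (h : ∀ i ∈ s, g i ≤ C) {i : ι} (hi : i ∈ s) : g i ≤ ⨆ i ∈ s, g i := by
  have hb : BddAbove (Set.range fun j => ⨆ _ : j ∈ s, g j) := by
    refine ⟨max C 0, ?_⟩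
    rintro _ ⟨j, rfl⟩
    exact Real.iSup_le (fun hj => (h j hj).trans (le_max_left _ _)) (le_max_right _ _)
  calc g i = ⨆ _ : i ∈ s, g i := by simp [hi]
    _ ≤ _ := le_ciSup hb i

theorem ContinuousMap.dist_sq_mul_le {X : Type*} [TopologicalSpace X] [CompactSpace X]
    {p : C(X, ℝ)} (hp : ∀ x, p x ∈ Set.Icc (0 : ℝ) 1) (f g : C(X, ℝ)) :
    dist (p ^ 2 * f) (p ^ 2 * g) ≤ dist f g := by
  refine (ContinuousMap.dist_le dist_nonneg).2 fun x => ?_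
  have h := ContinuousMap.dist_apply_le_dist (f := f) (g := g) x
  have h2 : (p x) ^ 2 ≤ 1 := pow_le_one₀ (hp x).1 (hp x).2
  simp only [ContinuousMap.mul_apply, ContinuousMap.pow_apply, Real.dist_eq] at h ⊢
  rw [← mul_sub, abs_mul, abs_of_nonneg (sq_nonneg (p x))]
  calc p x ^ 2 * |f x - g x| ≤ 1 * |f x - g x| := by gcongr
    _ ≤ _ := by simpa using h

/-- Real sequences bounded by `C` in absolute value converge along an ultrafilter. -/
theorem Ultrafilter.exists_tendsto_of_abs_le {ι : Type*} (ω : Ultrafilter ι) {t : ι → ℝ} {C : ℝ}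
    (h : ∀ k, |t k| ≤ C) : ∃ L, Tendsto t ω (𝓝 L) := by
  obtain ⟨L, -, hL⟩ := (isCompact_Icc (a := -C) (b := C)).ultrafilter_le_nhds (ω.map t)
    (le_principal_iff.2 (mem_map.2 (univ_mem' fun k => abs_le.1 (h k))))
  exact ⟨L, hL⟩

theorem uniformTraceNorm_le {X : Type*} [TopologicalSpace X] [MeasurableSpace X]
    {Δ : Set (ProbabilityMeasure X)} {h : C(X, ℝ)} {c : ℝ}
    (hc : 0 ≤ c) (H : ∀ μ ∈ Δ, ∫ x, (h x) ^ 2 ∂(μ : Measure X) ≤ c ^ 2) :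
    uniformTraceNorm Δ h ≤ c :=
  biSup_le_of_nonneg hc fun μ hμ => Real.sqrt_le_iff.2 ⟨hc, H μ hμ⟩

theorem ContinuousMap.exists_tendsto_integral {X : Type*} [TopologicalSpace X]
    [MeasurableSpace X] {ι : Type*} (ω : Ultrafilter ι) {C : ℝ} (f : ι → C(X, ℝ))
    (hf : ∀ k x, |f k x| ≤ C) (μs : ι → ProbabilityMeasure X) :
    ∃ L, Tendsto (fun k => ∫ x, f k x ∂(μs k : Measure X)) ω (𝓝 L) := by
  refine ω.exists_tendsto_of_abs_le (C := C) fun k => ?_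
  simpa using norm_integral_le_of_norm_le_const (μ := (μs k : Measure X)) (f := f k)
    (Eventually.of_forall fun x => hf k x)

section CompactSpace

variable {X : Type*} [TopologicalSpace X] [CompactSpace X] [MeasurableSpace X] [BorelSpace X]

theorem Continuous.integrable_of_compactSpace {f : X → ℝ} (hf : Continuous f)
    (μ : Measure X) [IsFiniteMeasure μ] : Integrable f μ :=
  hf.integrable_of_hasCompactSupport (HasCompactSupport.of_compactSpace f)

theorem ContinuousMap.integral_le_norm (f : C(X, ℝ)) (μ : Measure X) [IsProbabilityMeasure μ] :
    ∫ x, f x ∂μ ≤ ‖f‖ := by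
  calc ∫ x, f x ∂μ ≤ ∫ _, ‖f‖ ∂μ :=
        integral_mono (f.continuous.integrable_of_compactSpace μ) (integrable_const _)
          fun x => (le_abs_self _).trans (f.norm_coe_le_norm x)
    _ = ‖f‖ := by simp

theorem integral_le_biSup (Δ : Set (ProbabilityMeasure X)) {f : X → ℝ} (hf : Continuous f)
    {μ : ProbabilityMeasure X} (hμ : μ ∈ Δ) :
    ∫ x, f x ∂(μ : Measure X) ≤ ⨆ μ ∈ Δ, ∫ x, f x ∂(μ : Measure X) :=
  le_biSup_of_forall_le (g := fun μ : ProbabilityMeasure X => ∫ x, f x ∂(μ : Measure X))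
    (fun ν _ => ContinuousMap.integral_le_norm ⟨f, hf⟩ (ν : Measure X)) hμ

theorem integral_sq_le_of_uniformTraceNorm_le {Δ : Set (ProbabilityMeasure X)} {h : C(X, ℝ)}
    {c : ℝ} (H : uniformTraceNorm Δ h ≤ c) {μ : ProbabilityMeasure X} (hμ : μ ∈ Δ) :
    ∫ x, (h x) ^ 2 ∂(μ : Measure X) ≤ c ^ 2 := by
  have h1 : Real.sqrt (∫ x, (h x) ^ 2 ∂(μ : Measure X)) ≤ uniformTraceNorm Δ h :=
    le_biSup_of_forall_le
      (g := fun μ : ProbabilityMeasure X => Real.sqrt (∫ x, (h x) ^ 2 ∂(μ : Measure X)))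
      (fun ν _ => Real.sqrt_le_sqrt ((h ^ 2).integral_le_norm (ν : Measure X))) hμ
  exact (Real.sqrt_le_iff.1 (h1.trans H)).2

theorem integral_add_sum_sq_le (μ : Measure X) [IsProbabilityMeasure μ] {n : ℕ} {η : ℝ}
    {c a : X → ℝ} {b : Fin n → X → ℝ} (ha : Continuous a) (hb : ∀ i, Continuous (b i))
    (hc : ∀ x, c x = a x + ∑ i, b i x) (ha' : ∫ x, (a x) ^ 2 ∂μ ≤ η)
    (hb' : ∀ i, ∫ x, (b i x) ^ 2 ∂μ ≤ η) :
    ∫ x, (c x) ^ 2 ∂μ ≤ (2 + 2 * n ^ 2) * η := by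
  have hIa : Integrable (fun x => (a x) ^ 2) μ := (ha.pow 2).integrable_of_compactSpace μ
  have hI : ∀ i ∈ Finset.univ, Integrable (fun x => (b i x) ^ 2) μ := fun i _ =>
    ((hb i).pow 2).integrable_of_compactSpace μ
  have hcont : Continuous c := by
    rw [funext hc]
    fun_prop
  calc ∫ x, (c x) ^ 2 ∂μ ≤ ∫ x, (2 * (a x) ^ 2 + 2 * n * ∑ i, (b i x) ^ 2) ∂μ := by
        refine integral_mono ((hcont.pow 2).integrable_of_compactSpace μ)
          (Continuous.integrable_of_compactSpace (by fun_prop) μ) fun x => ?_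
        have h := sq_sum_le_card_mul_sum_sq (s := Finset.univ) (f := fun i => b i x)
        simp only [Finset.card_univ, Fintype.card_fin] at h
        simp only [hc x]
        nlinarith [sq_nonneg (a x - ∑ i, b i x)]
    _ = 2 * ∫ x, (a x) ^ 2 ∂μ + 2 * n * ∑ i, ∫ x, (b i x) ^ 2 ∂μ := by
        rw [integral_add (hIa.const_mul 2)
          ((integrable_finsetSum _ hI).const_mul _), integral_const_mul, integral_const_mul,
          integral_finsetSum _ hI]
    _ ≤ 2 * η + 2 * n * ∑ _i : Fin n, η := by
        gcongr with i
        exact hb' i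
    _ = (2 + 2 * n ^ 2) * η := by
        simp only [Finset.sum_const, Finset.card_univ, Fintype.card_fin, nsmul_eq_mul]
        ring

theorem ContinuousMap.integral_le_integral_add_of_dist_le (μ : Measure X)
    [IsProbabilityMeasure μ] {f g : C(X, ℝ)} {δ : ℝ} (h : dist f g ≤ δ) :
    ∫ x, f x ∂μ ≤ ∫ x, g x ∂μ + δ := by
  have h1 := (f - g).integral_le_norm μ
  rw [← dist_eq_norm] at h1
  simp only [ContinuousMap.sub_apply] at h1
  rw [integral_sub (f.continuous.integrable_of_compactSpace μ)
    (g.continuous.integrable_of_compactSpace μ)] at h1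
  linarith

end CompactSpace

/-- An inequality between limits for every sequence in `Δ` is eventually uniform on `Δ`, up
to an arbitrarily small error. -/
theorem eventually_integral_lt_of_limit_le {X : Type*} [TopologicalSpace X] [CompactSpace X]
    [MeasurableSpace X] {Δ : Set (ProbabilityMeasure X)} (ω : Ultrafilter ℕ) {p : ℕ → C(X, ℝ)}
    (hp : ∀ k x, p k x ∈ Set.Icc (0 : ℝ) 1) (f : C(X, ℝ))
    {c ε : ℝ} (hε : 0 < ε)
    (H : ∀ μs : ℕ → ProbabilityMeasure X, (∀ k, μs k ∈ Δ) → ∀ L₁ L₂ : ℝ,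
      Tendsto (fun k => ∫ x, (p k x) ^ 2 * f x ∂(μs k : Measure X)) ω (𝓝 L₁) →
      Tendsto (fun k => ∫ x, f x ∂(μs k : Measure X)) ω (𝓝 L₂) → L₁ ≤ c * L₂) :
    ∀ᶠ k in (ω : Filter ℕ), ∀ μ ∈ Δ,
      ∫ x, (p k x) ^ 2 * f x ∂(μ : Measure X) < c * (∫ x, f x ∂(μ : Measure X)) + ε := by
  by_contra hcon
  have hbad := Ultrafilter.eventually_not.2 hcon
  simp only [not_forall, not_lt] at hbad
  obtain ⟨_, μ₀, hμ₀, -⟩ := hbad.exists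
  have hch : ∀ k, ∃ μ ∈ Δ, (∃ μ ∈ Δ, c * (∫ x, f x ∂(μ : Measure X)) + ε ≤
      ∫ x, (p k x) ^ 2 * f x ∂(μ : Measure X)) →
      c * (∫ x, f x ∂(μ : Measure X)) + ε ≤ ∫ x, (p k x) ^ 2 * f x ∂(μ : Measure X) := by
    intro k
    by_cases hk : ∃ μ ∈ Δ, c * (∫ x, f x ∂(μ : Measure X)) + ε ≤
      ∫ x, (p k x) ^ 2 * f x ∂(μ : Measure X)
    · obtain ⟨μ, hμ, h⟩ := hk
      exact ⟨μ, hμ, fun _ => h⟩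
    · exact ⟨μ₀, hμ₀, fun h => absurd h hk⟩
  choose μs hμs hμs' using hch
  obtain ⟨L₂, hL₂⟩ := ContinuousMap.exists_tendsto_integral ω (fun _ => f)
    (fun _ x => f.norm_coe_le_norm x) μs
  obtain ⟨L₁, hL₁⟩ := ContinuousMap.exists_tendsto_integral ω (fun k => p k ^ 2 * f) (C := ‖f‖)
    (fun k x => by
      have h2 : (p k x) ^ 2 ≤ 1 := pow_le_one₀ (hp k x).1 (hp k x).2
      have h3 : |f x| ≤ ‖f‖ := f.norm_coe_le_norm x
      simp only [ContinuousMap.mul_apply, ContinuousMap.pow_apply]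
      rw [abs_mul, abs_of_nonneg (sq_nonneg (p k x))]
      nlinarith [abs_nonneg (f x)]) μs
  have h1 := H μs hμs L₁ L₂ hL₁ hL₂
  have h2 : c * L₂ + ε ≤ L₁ := by
    refine le_of_tendsto_of_tendsto ((hL₂.const_mul c).add_const ε) hL₁ ?_
    filter_upwards [hbad] with k hk
    obtain ⟨μ, hμ, h⟩ := hk
    exact hμs' k ⟨μ, hμ, h⟩
  linarith


theorem approximately_divisible_iff_local
    {X : Type*} [TopologicalSpace X] [CompactSpace X] [TopologicalSpace.MetrizableSpace X]
    [MeasurableSpace X] [BorelSpace X]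
    (Δ : Set (ProbabilityMeasure X)) (hΔ : IsClosed Δ)
    (ω : Ultrafilter ℕ) (hω : (ω : Filter ℕ) ≤ Filter.cofinite) :
    -- (A) approximate divisibility
    (∃ K : ℝ, 0 < K ∧ ∀ n : ℕ, 0 < n →
      ∃ p : Fin n → ℕ → C(X, ℝ),
        (∀ i k x, p i k x ∈ Set.Icc (0 : ℝ) 1) ∧
        (∀ i j, i ≠ j →
          Tendsto (fun k => ⨆ μ ∈ Δ, ∫ x, (p i k x * p j k x) ^ 2 ∂(μ : Measure X))
            (ω : Filter ℕ) (nhds 0)) ∧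
        (∀ i,
          Tendsto (fun k => ⨆ μ ∈ Δ, ∫ x, (p i k x - (p i k x) ^ 2) ^ 2 ∂(μ : Measure X))
            (ω : Filter ℕ) (nhds 0)) ∧
        (Tendsto (fun k => ⨆ μ ∈ Δ, ∫ x, (1 - ∑ i, p i k x) ^ 2 ∂(μ : Measure X))
            (ω : Filter ℕ) (nhds 0)) ∧
        (∀ (i : Fin n) (f : C(X, ℝ)), (∀ x, 0 ≤ f x) →
          ∀ μs : ℕ → ProbabilityMeasure X, (∀ k, μs k ∈ Δ) →
            ∀ L₁ L₂ : ℝ,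
              Tendsto (fun k => ∫ x, (p i k x) ^ 2 * f x ∂(μs k : Measure X))
                (ω : Filter ℕ) (nhds L₁) →
              Tendsto (fun k => ∫ x, f x ∂(μs k : Measure X))
                (ω : Filter ℕ) (nhds L₂) →
              L₁ ≤ (K / n) * L₂))
    ↔
    -- (B) local characterization
    (∃ K : ℝ, 0 < K ∧ ∀ F : Finset C(X, ℝ), (∀ f ∈ F, ∀ x, 0 ≤ f x) →
      ∀ ε : ℝ, 0 < ε → ∀ n : ℕ, 0 < n →
        ∃ p : Fin n → C(X, ℝ),
          (∀ i x, p i x ∈ Set.Icc (0 : ℝ) 1) ∧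
          (∀ i j, i ≠ j → uniformTraceNorm Δ (p i * p j) < ε) ∧
          (∀ i, uniformTraceNorm Δ (p i - p i * p i) < ε) ∧
          uniformTraceNorm Δ (1 - ∑ i, p i * p i) < ε ∧
          (∀ i : Fin n, ∀ f ∈ F, ∀ μ ∈ Δ,
            (∫ x, (p i x) ^ 2 * f x ∂(μ : Measure X)) <
              (K / n) * (∫ x, f x ∂(μ : Measure X)) + ε)) := by
  constructor
  · rintro ⟨K, hK, hA⟩
    refine ⟨K, hK, fun F hF ε hε n hn => ?_⟩
    obtain ⟨p, hp, h1, h2, h3, h4⟩ := hA n hn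
    have hn' : (0 : ℝ) ≤ 2 * n ^ 2 := by positivity
    set η : ℝ := (ε / 2) ^ 2 / (2 + 2 * n ^ 2) with hη
    have hη0 : 0 < η := by positivity
    have hη1 : (2 + 2 * n ^ 2) * η = (ε / 2) ^ 2 := by
      rw [hη]
      field_simp
    have hη2 : η ≤ (ε / 2) ^ 2 := by nlinarith
    have e1 : ∀ᶠ k in (ω : Filter ℕ), ∀ i j, i ≠ j →
        ⨆ μ ∈ Δ, ∫ x, (p i k x * p j k x) ^ 2 ∂(μ : Measure X) < η := by
      simp only [eventually_all]
      exact fun i j hij => (h1 i j hij).eventually_lt_const hη0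
    have e2 : ∀ᶠ k in (ω : Filter ℕ), ∀ i,
        ⨆ μ ∈ Δ, ∫ x, (p i k x - (p i k x) ^ 2) ^ 2 ∂(μ : Measure X) < η :=
      eventually_all.2 fun i => (h2 i).eventually_lt_const hη0
    have e4 : ∀ᶠ k in (ω : Filter ℕ), ∀ i, ∀ f ∈ F, ∀ μ ∈ Δ,
        (∫ x, (p i k x) ^ 2 * f x ∂(μ : Measure X)) <
          (K / n) * (∫ x, f x ∂(μ : Measure X)) + ε :=
      eventually_all.2 fun i => (Filter.eventually_all_finset F).2 fun f hf =>
        eventually_integral_lt_of_limit_le ω (hp i) f hε (h4 i f (hF f hf))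
    obtain ⟨k, k1, k2, k3, k4⟩ :=
      (e1.and (e2.and ((h3.eventually_lt_const hη0).and e4))).exists
    have hε2 : ε / 2 < ε := half_lt_self hε
    have k2' : ∀ i, ∀ μ ∈ Δ, ∫ x, (p i k x - (p i k x) ^ 2) ^ 2 ∂(μ : Measure X) ≤ η :=
      fun i μ hμ => (integral_le_biSup Δ (by fun_prop) hμ).trans (k2 i).le
    refine ⟨fun i => p i k, fun i => hp i k, fun i j hij => ?_, fun i => ?_, ?_, k4⟩
    · refine (uniformTraceNorm_le (half_pos hε).le fun μ hμ => ?_).trans_lt hε2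
      exact (integral_le_biSup Δ (by fun_prop) hμ).trans ((k1 i j hij).le.trans hη2)
    · refine (uniformTraceNorm_le (half_pos hε).le fun μ hμ => ?_).trans_lt hε2
      simpa [pow_two (p i k _)] using (k2' i μ hμ).trans hη2
    · refine (uniformTraceNorm_le (half_pos hε).le fun μ hμ => ?_).trans_lt hε2
      rw [← hη1]
      refine integral_add_sum_sq_le (μ : Measure X) (a := fun x => 1 - ∑ i, p i k x)
        (b := fun i x => p i k x - (p i k x) ^ 2) (by fun_prop) (fun i => by fun_prop)
        (fun x => ?_) ((integral_le_biSup Δ (by fun_prop) hμ).trans k3.le)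
        fun i => k2' i μ hμ
      simp [Finset.sum_sub_distrib, pow_two]
  · rintro ⟨K, hK, hB⟩
    refine ⟨K, hK, fun n hn => ?_⟩
    have : Nonempty {f : C(X, ℝ) // ∀ x, 0 ≤ f x} := ⟨⟨0, fun _ => le_rfl⟩⟩
    let g := TopologicalSpace.denseSeq {f : C(X, ℝ) // ∀ x, 0 ≤ f x}
    classical
    have hB' := fun k : ℕ => hB ((Finset.range k).image fun m => (g m : C(X, ℝ)))
      (fun f hf => by
        obtain ⟨m, -, rfl⟩ := Finset.mem_image.1 hf
        exact (g m).2) (1 / ((k : ℝ) + 1)) (by positivity) n hn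
    choose p hp h1 h2 h3 h4 using hB'
    have hω' : (ω : Filter ℕ) ≤ atTop := Nat.cofinite_eq_atTop ▸ hω
    have hlim : Tendsto (fun k : ℕ => 1 / ((k : ℝ) + 1)) (ω : Filter ℕ) (𝓝 0) :=
      tendsto_one_div_add_atTop_nhds_zero_nat.mono_left hω'
    have key : ∀ (C : ℝ), 0 ≤ C → ∀ q : ℕ → X → ℝ,
        (∀ k, ∀ μ ∈ Δ, ∫ x, (q k x) ^ 2 ∂(μ : Measure X) ≤ C * (1 / ((k : ℝ) + 1)) ^ 2) →
        Tendsto (fun k => ⨆ μ ∈ Δ, ∫ x, (q k x) ^ 2 ∂(μ : Measure X)) (ω : Filter ℕ)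
          (𝓝 0) := by
      intro C hC q hq
      have hlim' := (hlim.pow 2).const_mul C
      rw [zero_pow two_ne_zero, mul_zero] at hlim'
      refine squeeze_zero (fun k => ?_) (fun k => biSup_le_of_nonneg (by positivity) (hq k)) hlim'
      exact Real.iSup_nonneg fun μ => Real.iSup_nonneg fun _ =>
        integral_nonneg fun x => sq_nonneg _
    have b2 : ∀ k i, ∀ μ ∈ Δ, ∫ x, (p k i x - (p k i x) ^ 2) ^ 2 ∂(μ : Measure X) ≤
        (1 / ((k : ℝ) + 1)) ^ 2 := fun k i μ hμ => by
      simpa [pow_two (p k i _)] using integral_sq_le_of_uniformTraceNorm_le (h2 k i).le hμ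
    refine ⟨fun i k => p k i, fun i k => hp k i, fun i j hij => ?_, fun i => ?_, ?_, ?_⟩
    · refine key 1 zero_le_one (fun k x => p k i x * p k j x) fun k μ hμ => ?_
      rw [one_mul]
      exact integral_sq_le_of_uniformTraceNorm_le (h1 k i j hij).le hμ
    · refine key 1 zero_le_one (fun k x => p k i x - (p k i x) ^ 2) fun k μ hμ => ?_
      rw [one_mul]
      exact b2 k i μ hμ
    · refine key (2 + 2 * n ^ 2) (by positivity) (fun k x => 1 - ∑ i, p k i x) fun k μ hμ => ?_
      refine integral_add_sum_sq_le (μ : Measure X) (a := (1 - ∑ i, p k i * p k i : C(X, ℝ)))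
        (b := fun i x => -(p k i x - (p k i x) ^ 2)) (by fun_prop) (fun i => by fun_prop)
        (fun x => ?_) (integral_sq_le_of_uniformTraceNorm_le (h3 k).le hμ) fun i => ?_
      · simp [Finset.sum_sub_distrib, pow_two]
      · simpa only [neg_sq] using b2 k i μ hμ
    · intro i f hf μs hμs L₁ L₂ hL₁ hL₂
      have hKn : 0 ≤ K / n := by positivity
      suffices H : ∀ δ > 0, L₁ ≤ K / n * (L₂ + δ) + δ by
        have hc : Tendsto (fun δ : ℝ => K / n * (L₂ + δ) + δ) (𝓝[>] 0)
            (𝓝 (K / n * (L₂ + 0) + 0)) :=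
          (Continuous.tendsto (by fun_prop) 0).mono_left nhdsWithin_le_nhds
        rw [add_zero, add_zero] at hc
        exact ge_of_tendsto hc (eventually_mem_nhdsWithin.mono H)
      intro δ hδ
      obtain ⟨m, hm⟩ := (TopologicalSpace.denseRange_denseSeq
        {f : C(X, ℝ) // ∀ x, 0 ≤ f x}).exists_dist_lt ⟨f, hf⟩ hδ
      have hm' : dist f (g m) ≤ δ := hm.le
      have hR : Tendsto (fun k : ℕ => K / n * (∫ x, f x ∂(μs k : Measure X) + δ) +
          1 / ((k : ℝ) + 1) + δ) (ω : Filter ℕ) (𝓝 (K / n * (L₂ + δ) + 0 + δ)) :=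
        (((hL₂.add_const δ).const_mul _).add hlim).add_const δ
      rw [add_zero] at hR
      refine le_of_tendsto_of_tendsto hL₁ hR ?_
      filter_upwards [hω' (eventually_gt_atTop m)] with k hk
      have s1 := h4 k i (g m) (Finset.mem_image.2 ⟨m, Finset.mem_range.2 hk, rfl⟩) (μs k) (hμs k)
      have s2 := ContinuousMap.integral_le_integral_add_of_dist_le (μs k : Measure X)
        ((ContinuousMap.dist_sq_mul_le (hp k i) f (g m)).trans hm')
      have s3 := mul_le_mul_of_nonneg_left
        (ContinuousMap.integral_le_integral_add_of_dist_le (μs k : Measure X)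
          (dist_comm f _ ▸ hm')) hKn
      simp only [ContinuousMap.mul_apply, ContinuousMap.pow_apply] at s2
      linarith
end

section
/- Let X be a compact metrizable topological space and let Δ be a weak-*-closed set of Borel probability measures on X. Suppose there is K > 0 such that for every finite set F of continuous functions X → [0,∞), every ε > 0, and every n ∈ ℕ, there exist continuous functions p_1, ..., p_n : X → [0,1] such that: (1) ‖p_i p_j‖_{2,Δ} < ε for all i ≠ j; (2) ‖p_i − p_i²‖_{2,Δ} < ε for each i; (3) ‖1 − (p_1² + ... + p_n²)‖_{2,Δ} < ε; and (4) ∫_X p_i² f dμ < (K/n) ∫_X f dμ + ε for each i = 1, ..., n, each f ∈ F, and each μ ∈ Δ. Then (X, Δ) has the small boundary property. -/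
open MeasureTheory Filter Topology
open scoped NNReal ENNReal

/-- The pair `(X, Δ)` has the small boundary property. -/
def SmallBoundaryProperty {X : Type*} [TopologicalSpace X] [MeasurableSpace X]
    (Δ : Set (ProbabilityMeasure X)) : Prop :=
  ∀ (x : X) (U : Set X), IsOpen U → x ∈ U →
    ∃ V : Set X, IsClosed V ∧ x ∈ interior V ∧ V ⊆ U ∧
      ∀ μ ∈ Δ, μ (frontier V) = 0

theorem integral_sq_lt_of_uniformTraceNorm_lt {X : Type*} [TopologicalSpace X] [CompactSpace X]
    [MeasurableSpace X] [BorelSpace X] {Δ : Set (ProbabilityMeasure X)} {h : C(X, ℝ)} {e : ℝ}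
    (he : uniformTraceNorm Δ h < e) {μ : ProbabilityMeasure X} (hμ : μ ∈ Δ) :
    ∫ x, (h x) ^ 2 ∂(μ : Measure X) < e ^ 2 := by
  have hbound : ∀ ν : ProbabilityMeasure X,
      Real.sqrt (∫ x, (h x) ^ 2 ∂(ν : Measure X)) ≤ ‖h‖ := by
    intro ν
    refine Real.sqrt_le_iff.2 ⟨norm_nonneg _, ?_⟩
    have hle : ∫ x, (h x) ^ 2 ∂(ν : Measure X) ≤ ∫ _, ‖h‖ ^ 2 ∂(ν : Measure X) := by
      refine integral_mono_of_nonneg (Eventually.of_forall fun x => sq_nonneg _)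
        (integrable_const _) (Eventually.of_forall fun x => ?_)
      exact sq_le_sq.2 (by simpa using h.norm_coe_le_norm x)
    simpa using hle
  have hle : Real.sqrt (∫ x, (h x) ^ 2 ∂(μ : Measure X)) ≤ uniformTraceNorm Δ h := by
    unfold uniformTraceNorm
    refine le_trans (le_of_eq ?_) (le_ciSup (f := fun ν : ProbabilityMeasure X =>
      ⨆ _ : ν ∈ Δ, Real.sqrt (∫ x, (h x) ^ 2 ∂(ν : Measure X))) ⟨‖h‖, ?_⟩ μ)
    · simp [hμ]
    · rintro _ ⟨ν, rfl⟩
      exact Real.iSup_le (fun _ => hbound ν) (norm_nonneg _)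
  exact (Real.sqrt_lt' ((Real.sqrt_nonneg _).trans_lt (hle.trans_lt he))).1 (hle.trans_lt he)

/-- If the `q i ∈ [0, 1]` are almost idempotent and their squares almost sum to `1`, then one of
them is almost `1`, and the truncated combination of the points `η i / n` with weights `(q i) ^ 2`
is close to the corresponding point. -/
theorem exists_dominant_weight {n : ℕ} (hn : 0 < n) {η : ℝ} (hη : 0 < η) (q : Fin n → ℝ)
    (hq : ∀ i, q i ∈ Set.Icc (0 : ℝ) 1)
    (hQ : ∑ i, (q i - q i * q i) ^ 2 + (1 - ∑ i, q i * q i) ^ 2 < (1 / (40 * (n : ℝ) ^ 2)) ^ 2) :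
    ∃ i, 1 / 2 ≤ (q i) ^ 2 ∧
      |min η (∑ j, q j ^ 2 * (η / n * (j : ℕ))) - η / n * (i : ℕ)| ≤ η / n / 8 := by
  have hn1 : (1 : ℝ) ≤ n := by exact_mod_cast hn
  set σ : ℝ := 1 / (40 * (n : ℝ) ^ 2) with hσ
  have hσ0 : 0 < σ := by positivity
  have hσn : 40 * (n : ℝ) ^ 2 * σ = 1 := by rw [hσ]; field_simp
  have hidem : ∀ i, q i - q i * q i < σ := by
    intro i
    refine lt_of_pow_lt_pow_left₀ 2 hσ0.le (lt_of_le_of_lt ?_ hQ)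
    have := Finset.single_le_sum (f := fun i => (q i - q i * q i) ^ 2)
      (fun j _ => sq_nonneg _) (Finset.mem_univ i)
    have h2 := sq_nonneg (1 - ∑ i, q i * q i)
    linarith
  have hsum : |1 - ∑ i, q i * q i| < σ := by
    refine abs_lt_of_sq_lt_sq (lt_of_le_of_lt ?_ hQ) hσ0.le
    have : 0 ≤ ∑ i, (q i - q i * q i) ^ 2 := Finset.sum_nonneg fun j _ => sq_nonneg _
    linarith
  obtain ⟨hsum1, hsum2⟩ := abs_lt.1 hsum
  obtain ⟨i, hi⟩ : ∃ i, 1 / (2 * (n : ℝ)) ≤ q i * q i := by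
    by_contra! hcon
    have h1 : ∑ i, q i * q i ≤ ∑ _i : Fin n, 1 / (2 * (n : ℝ)) :=
      Finset.sum_le_sum fun i _ => (hcon i).le
    have h2 : ∑ _i : Fin n, 1 / (2 * (n : ℝ)) = 1 / 2 := by
      simp; field_simp
    nlinarith
  have hnσ : 40 * (n * σ) ≤ 1 := by nlinarith [mul_pos (lt_of_lt_of_le one_pos hn1) hσ0]
  have hqi0 := (hq i).1
  have hqi1 := (hq i).2
  have hqi : 1 - q i ≤ 2 * (n * σ) := by
    have h1 : 1 / (2 * (n : ℝ)) ≤ q i := hi.trans (mul_le_of_le_one_left hqi0 hqi1)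
    have h2 : 1 / (2 * (n : ℝ)) * (1 - q i) ≤ σ := by nlinarith [hidem i]
    rw [div_mul_eq_mul_div, div_le_iff₀ (by positivity)] at h2
    linarith
  refine ⟨i, by nlinarith, ?_⟩
  have ht : ∀ j : Fin n, 0 ≤ η / n * (j : ℕ) ∧ η / n * (j : ℕ) ≤ η := by
    intro j
    refine ⟨by positivity, ?_⟩
    have : ((j : ℕ) : ℝ) ≤ n := by exact_mod_cast j.2.le
    rw [div_mul_eq_mul_div, div_le_iff₀ (by positivity)]
    exact mul_le_mul_of_nonneg_left this hη.le
  have hsplit := Finset.add_sum_erase Finset.univ (fun j => q j ^ 2 * (η / n * (j : ℕ)))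
    (Finset.mem_univ i)
  have hsplit' := Finset.add_sum_erase Finset.univ (fun j => q j * q j) (Finset.mem_univ i)
  set R := ∑ j ∈ Finset.univ.erase i, q j ^ 2 * (η / n * (j : ℕ))
  have hR0 : 0 ≤ R := Finset.sum_nonneg fun j _ => mul_nonneg (sq_nonneg _) (ht j).1
  have hR1 : R ≤ (∑ j ∈ Finset.univ.erase i, q j * q j) * η := by
    rw [Finset.sum_mul]
    refine Finset.sum_le_sum fun j _ => ?_
    rw [← sq]
    exact mul_le_mul_of_nonneg_left (ht j).2 (sq_nonneg _)
  have hsmall : 5 * (n * σ) * η = η / n / 8 := by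
    rw [hσ]; field_simp; norm_num
  have hσ' : σ ≤ n * σ := le_mul_of_one_le_left hσ0.le hn1
  have hsq : 1 - q i ^ 2 ≤ 4 * (n * σ) := by nlinarith
  have hR2 : R ≤ η / n / 8 := by
    rw [← hsmall]
    refine hR1.trans (mul_le_mul_of_nonneg_right ?_ hη.le)
    nlinarith
  obtain ⟨ht0, ht1⟩ := ht i
  rw [← hsplit]
  set t := η / n * ((i : ℕ) : ℝ)
  have hlow : t - η / n / 8 ≤ q i ^ 2 * t := by
    have h1 : (1 - q i ^ 2) * t ≤ 4 * (n * σ) * η := by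
      refine mul_le_mul hsq ht1 ht0 (by positivity)
    have h2 : 0 ≤ n * σ * η := by positivity
    linarith
  have hup : q i ^ 2 * t ≤ t := mul_le_of_le_one_left ht0 (pow_le_one₀ hqi0 hqi1)
  have hd : 0 < η / n / 8 := by positivity
  rw [abs_le]
  constructor
  · have : t - η / n / 8 ≤ min η (q i ^ 2 * t + R) := le_min (by linarith) (by linarith)
    linarith
  · have := min_le_right η (q i ^ 2 * t + R)
    linarith

/-- The tent functions of width `d` centred at the points `d i` have disjoint supports. -/
theorem sum_tent_le_one {n : ℕ} {d : ℝ} (hd : 0 < d) (y : ℝ) :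
    ∑ i : Fin n, max 0 (1 - 2 * |y - d * (i : ℕ)| / d) ≤ 1 := by
  by_cases h : ∃ i : Fin n, 0 < 1 - 2 * |y - d * (i : ℕ)| / d
  · obtain ⟨i, hi⟩ := h
    rw [Finset.sum_eq_single i]
    · refine max_le zero_le_one ?_
      have : 0 ≤ 2 * |y - d * (i : ℕ)| / d := by positivity
      linarith
    · intro j _ hji
      refine max_eq_left ?_
      by_contra! hj
      rw [sub_pos, div_lt_one hd] at hi hj
      have hlt : |d * (i : ℕ) - d * (j : ℕ)| < d * 1 := by
        have := abs_sub_le (d * (i : ℕ)) y (d * (j : ℕ))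
        rw [abs_sub_comm _ y] at this
        linarith
      rw [← mul_sub, abs_mul, abs_of_pos hd] at hlt
      have hlt' := lt_of_mul_lt_mul_left hlt hd.le
      have hz : |((i : ℕ) : ℤ) - ((j : ℕ) : ℤ)| < 1 := by exact_mod_cast hlt'
      rw [Int.abs_lt_one_iff] at hz
      exact hji (Fin.ext (by omega))
    · simp
  · push Not at h
    rw [Finset.sum_eq_zero fun i _ => max_eq_left (h i)]
    exact zero_le_one

/-- Under approximate divisibility (whose orthogonality condition is not needed here), every
continuous function can be uniformly perturbed so that it is bounded away from zero
off a set of small measure, uniformly over `Δ`. -/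
theorem exists_perturbation_measure_le {X : Type*} [TopologicalSpace X] [CompactSpace X]
    [MeasurableSpace X] [BorelSpace X] {Δ : Set (ProbabilityMeasure X)} {K : ℝ}
    (hdiv : ∀ F : Finset C(X, ℝ), (∀ f ∈ F, ∀ x, 0 ≤ f x) →
      ∀ ε : ℝ, 0 < ε → ∀ n : ℕ, 0 < n →
        ∃ p : Fin n → C(X, ℝ),
          (∀ i x, p i x ∈ Set.Icc (0 : ℝ) 1) ∧
          (∀ i, uniformTraceNorm Δ (p i - p i * p i) < ε) ∧
          uniformTraceNorm Δ (1 - ∑ i, p i * p i) < ε ∧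
          (∀ i : Fin n, ∀ f ∈ F, ∀ μ ∈ Δ,
            (∫ x, (p i x) ^ 2 * f x ∂(μ : Measure X)) <
              (K / n) * (∫ x, f x ∂(μ : Measure X)) + ε))
    (hK : 0 < K) (f : C(X, ℝ)) {η ε : ℝ} (hη : 0 < η) (hε : 0 < ε) :
    ∃ g : C(X, ℝ), dist g f ≤ η ∧ ∃ δ > 0, ∀ μ ∈ Δ,
      (μ : Measure X).real {x | |g x| ≤ δ} ≤ ε := by
  classical
  obtain ⟨n, hn⟩ := exists_nat_gt (8 * K / ε)
  have hn0' : (0 : ℝ) < n := lt_trans (by positivity) hn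
  have hn0 : 0 < n := by exact_mod_cast hn0'
  set d : ℝ := η / n with hd
  have hd0 : 0 < d := by positivity
  set σ : ℝ := 1 / (40 * (n : ℝ) ^ 2) with hσ
  have hσ0 : 0 < σ := by positivity
  set M : ℝ := 4 * n + (n + 1) / σ ^ 2 with hM
  have hM0 : 0 < M := by positivity
  set e : ℝ := min 1 (ε / (2 * M)) with he
  have he0 : 0 < e := lt_min one_pos (by positivity)
  let φ : Fin n → C(X, ℝ) := fun i =>
    ⟨fun x => max 0 (1 - 2 * |f x - d * (i : ℕ)| / d), by fun_prop⟩
  have hφ : ∀ i x, φ i x = max 0 (1 - 2 * |f x - d * (i : ℕ)| / d) := fun _ _ => rfl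
  obtain ⟨p, hp, hidem, hsum, hsmall⟩ := hdiv (Finset.univ.image φ)
    (by simp only [Finset.mem_image]; rintro _ ⟨i, -, rfl⟩ x; exact le_max_left _ _) e he0 n hn0
  let h : C(X, ℝ) := ⟨fun x => min η (∑ j, p j x ^ 2 * (d * (j : ℕ))), by fun_prop⟩
  have hh : ∀ x, h x = min η (∑ j, p j x ^ 2 * (d * (j : ℕ))) := fun _ => rfl
  refine ⟨f - h, ?_, d / 8, by positivity, fun μ hμ => ?_⟩
  · rw [ContinuousMap.dist_le hη.le]
    intro x
    have h0 : 0 ≤ h x := by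
      rw [hh]
      exact le_min hη.le (Finset.sum_nonneg fun j _ => by positivity)
    have h1 : h x ≤ η := by rw [hh]; exact min_le_left _ _
    rw [Real.dist_eq, ContinuousMap.sub_apply, abs_le]
    constructor <;> linarith
  have hint : ∀ u : C(X, ℝ), Integrable (fun x => u x) (μ : Measure X) := fun u =>
    u.continuous.integrable_of_hasCompactSupport (HasCompactSupport.of_compactSpace _)
  set Q : X → ℝ := fun x =>
    ∑ i, (p i x - p i x * p i x) ^ 2 + (1 - ∑ i, p i x * p i x) ^ 2 with hQ
  have hQ0 : ∀ x, 0 ≤ Q x := fun x =>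
    add_nonneg (Finset.sum_nonneg fun i _ => sq_nonneg _) (sq_nonneg _)
  have hpoint : ∀ x, Set.indicator {x | |(f - h) x| ≤ d / 8} (1 : X → ℝ) x ≤
      4 * ∑ i, p i x ^ 2 * φ i x + Q x / σ ^ 2 := by
    intro x
    have hA : ∀ i, 0 ≤ p i x ^ 2 * φ i x := fun i =>
      mul_nonneg (sq_nonneg _) (le_max_left _ _)
    have hA' : 0 ≤ ∑ i, p i x ^ 2 * φ i x := Finset.sum_nonneg fun i _ => hA i
    have hB : 0 ≤ Q x / σ ^ 2 := div_nonneg (hQ0 x) (sq_nonneg _)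
    refine Set.indicator_apply_le' (fun hx => ?_) (fun _ => by positivity)
    rw [Set.mem_ofPred_eq, ContinuousMap.sub_apply] at hx
    rw [Pi.one_apply]
    by_cases hc : Q x < σ ^ 2
    · obtain ⟨i, hi, hi'⟩ := exists_dominant_weight hn0 hη (fun i => p i x) (fun i => hp i x) hc
      have hdist : |f x - d * (i : ℕ)| ≤ d / 4 := by
        have := abs_sub_le (f x) (h x) (d * (i : ℕ))
        rw [← hd, ← hh] at hi'
        linarith
      have hφi : 1 / 2 ≤ φ i x := by
        rw [hφ]
        refine le_max_of_le_right ?_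
        have : 2 * |f x - d * (i : ℕ)| / d ≤ 1 / 2 := by
          rw [div_le_iff₀ hd0]; linarith
        linarith
      have hle := Finset.single_le_sum (f := fun i => p i x ^ 2 * φ i x) (fun i _ => hA i)
        (Finset.mem_univ i)
      have : 1 / 2 * (1 / 2) ≤ p i x ^ 2 * φ i x :=
        mul_le_mul hi hφi (by norm_num) (sq_nonneg _)
      linarith
    · have : 1 ≤ Q x / σ ^ 2 := by
        rw [le_div_iff₀ (by positivity)]; linarith
      linarith
  have hintA : ∀ i, Integrable (fun x => p i x ^ 2 * φ i x) (μ : Measure X) := fun i =>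
    hint (p i ^ 2 * φ i)
  have hintB : ∀ i, Integrable (fun x => (p i x - p i x * p i x) ^ 2) (μ : Measure X) := fun i =>
    hint ((p i - p i * p i) ^ 2)
  have hintC : Integrable (fun x => (1 - ∑ i, p i x * p i x) ^ 2) (μ : Measure X) := by
    refine (hint ((1 - ∑ i, p i * p i) ^ 2)).congr (Eventually.of_forall fun x => ?_)
    simp [ContinuousMap.pow_apply]
  have hintQ : Integrable Q (μ : Measure X) :=
    (integrable_finsetSum _ fun i _ => hintB i).add hintC
  have hintS : Integrable (fun x => ∑ i, p i x ^ 2 * φ i x) (μ : Measure X) :=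
    integrable_finsetSum _ fun i _ => hintA i
  have hmeas : MeasurableSet {x | |(f - h) x| ≤ d / 8} :=
    (isClosed_le (f - h).continuous.abs continuous_const).measurableSet
  have hmain : (μ : Measure X).real {x | |(f - h) x| ≤ d / 8} ≤
      4 * ∑ i, ∫ x, p i x ^ 2 * φ i x ∂(μ : Measure X) + (∫ x, Q x ∂(μ : Measure X)) / σ ^ 2 := by
    rw [← integral_indicator_one hmeas, ← integral_finsetSum _ fun i _ => hintA i,
      ← integral_const_mul, ← integral_div, ← integral_add (hintS.const_mul _) (hintQ.div_const _)]
    exact integral_mono ((integrable_const 1).indicator hmeas)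
      ((hintS.const_mul _).add (hintQ.div_const _)) hpoint
  have hsumφ : ∑ i, ∫ x, φ i x ∂(μ : Measure X) ≤ 1 := by
    rw [← integral_finsetSum _ fun i _ => hint (φ i)]
    calc ∫ x, ∑ i, φ i x ∂(μ : Measure X) ≤ ∫ _, (1 : ℝ) ∂(μ : Measure X) :=
          integral_mono (integrable_finsetSum _ fun i _ => hint (φ i)) (integrable_const _)
            fun x => sum_tent_le_one hd0 (f x)
      _ = 1 := by simp
  have hS : ∑ i, ∫ x, p i x ^ 2 * φ i x ∂(μ : Measure X) ≤ K / n + n * e := by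
    calc ∑ i, ∫ x, p i x ^ 2 * φ i x ∂(μ : Measure X)
        ≤ ∑ i, (K / n * ∫ x, φ i x ∂(μ : Measure X) + e) :=
          Finset.sum_le_sum fun i _ => (hsmall i (φ i) (by simp) μ hμ).le
      _ = K / n * ∑ i, ∫ x, φ i x ∂(μ : Measure X) + n * e := by
          simp [Finset.sum_add_distrib, Finset.mul_sum]
      _ ≤ K / n + n * e := by
          gcongr
          exact mul_le_of_le_one_right (by positivity) hsumφ
  have hQint : ∫ x, Q x ∂(μ : Measure X) ≤ (n + 1) * e := by
    have he2 : e ^ 2 ≤ e := pow_le_of_le_one he0.le (min_le_left _ _) two_ne_zero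
    rw [hQ, integral_add (integrable_finsetSum _ fun i _ => hintB i) hintC,
      integral_finsetSum _ fun i _ => hintB i]
    have h1 : ∀ i, ∫ x, (p i x - p i x * p i x) ^ 2 ∂(μ : Measure X) ≤ e := fun i =>
      (integral_sq_lt_of_uniformTraceNorm_lt (hidem i) hμ).le.trans he2
    have h2 : ∫ x, (1 - ∑ i, p i x * p i x) ^ 2 ∂(μ : Measure X) ≤ e := by
      simpa using (integral_sq_lt_of_uniformTraceNorm_lt hsum hμ).le.trans he2
    have h3 : ∑ i, ∫ x, (p i x - p i x * p i x) ^ 2 ∂(μ : Measure X) ≤ n * e := by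
      simpa using Finset.sum_le_sum fun i (_ : i ∈ Finset.univ) => h1 i
    linarith
  have hKn : 4 * (K / n) ≤ ε / 2 := by
    rw [div_lt_iff₀ hε] at hn
    rw [mul_div_assoc', div_le_iff₀ hn0']
    linarith
  have hMe : M * e ≤ ε / 2 := by
    calc M * e ≤ M * (ε / (2 * M)) := mul_le_mul_of_nonneg_left (min_le_right _ _) hM0.le
      _ = ε / 2 := by field_simp
  have hQdiv : (∫ x, Q x ∂(μ : Measure X)) / σ ^ 2 ≤ (n + 1) / σ ^ 2 * e := by
    rw [div_mul_eq_mul_div]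
    gcongr
  have hMexp : M * e = 4 * (n * e) + (n + 1) / σ ^ 2 * e := by rw [hM]; ring
  linarith

/-- If every continuous function can be perturbed so that it is bounded away from zero off a set
of small measure, uniformly over `Δ`, then a Baire category argument makes
the zero set null for all `μ ∈ Δ` at once. -/
theorem dense_setOf_measure_zeros_eq_zero {X : Type*} [TopologicalSpace X] [CompactSpace X]
    [MeasurableSpace X] {Δ : Set (ProbabilityMeasure X)}
    (hpert : ∀ (f : C(X, ℝ)) (η ε : ℝ), 0 < η → 0 < ε →
      ∃ g : C(X, ℝ), dist g f ≤ η ∧ ∃ δ > 0, ∀ μ ∈ Δ,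
        (μ : Measure X).real {x | |g x| ≤ δ} ≤ ε) :
    Dense {g : C(X, ℝ) | ∀ μ ∈ Δ, (μ : Measure X) {x | g x = 0} = 0} := by
  let G : ℕ → Set C(X, ℝ) := fun m => {g | ∃ δ > 0, ∀ μ ∈ Δ,
    (μ : Measure X).real {x | |g x| ≤ δ} ≤ 1 / ((m : ℝ) + 1)}
  have hopen : ∀ m, IsOpen (G m) := by
    intro m
    rw [Metric.isOpen_iff]
    rintro g ⟨δ, hδ, hg⟩
    refine ⟨δ / 2, half_pos hδ, fun g' hg' => ⟨δ / 2, half_pos hδ, fun μ hμ => ?_⟩⟩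
    refine (measureReal_mono fun x hx => ?_).trans (hg μ hμ)
    have h1 : |g x - g' x| ≤ δ / 2 := by
      rw [← Real.dist_eq, dist_comm]
      exact (ContinuousMap.dist_apply_le_dist x).trans (Metric.mem_ball.1 hg').le
    have h2 := abs_add_le (g x - g' x) (g' x)
    rw [sub_add_cancel] at h2
    rw [Set.mem_ofPred_eq] at hx ⊢
    linarith
  have hdense : ∀ m, Dense (G m) := by
    intro m
    rw [Metric.dense_iff]
    intro f r hr
    obtain ⟨g, hgf, hg⟩ := hpert f (r / 2) (1 / ((m : ℝ) + 1)) (half_pos hr) (by positivity)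
    exact ⟨g, Metric.mem_ball.2 (hgf.trans_lt (half_lt_self hr)), hg⟩
  refine (dense_iInter_of_isOpen_nat hopen hdense).mono fun g hg μ hμ => ?_
  rw [Set.mem_iInter] at hg
  rw [← measureReal_eq_zero_iff]
  refine le_antisymm (ge_of_tendsto' tendsto_one_div_add_atTop_nhds_zero_nat fun m => ?_)
    measureReal_nonneg
  obtain ⟨δ, hδ, hm⟩ := hg m
  refine (measureReal_mono fun x hx => ?_).trans (hm μ hμ)
  rw [Set.mem_ofPred_eq] at hx ⊢
  simpa [hx] using hδ.le

theorem sbp_of_approximately_divisible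
    {X : Type*} [TopologicalSpace X] [CompactSpace X] [TopologicalSpace.MetrizableSpace X]
    [MeasurableSpace X] [BorelSpace X]
    (Δ : Set (ProbabilityMeasure X)) (hΔ : IsClosed Δ)
    (hdiv : ∃ K : ℝ, 0 < K ∧ ∀ F : Finset C(X, ℝ), (∀ f ∈ F, ∀ x, 0 ≤ f x) →
      ∀ ε : ℝ, 0 < ε → ∀ n : ℕ, 0 < n →
        ∃ p : Fin n → C(X, ℝ),
          (∀ i x, p i x ∈ Set.Icc (0 : ℝ) 1) ∧
          (∀ i j, i ≠ j → uniformTraceNorm Δ (p i * p j) < ε) ∧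
          (∀ i, uniformTraceNorm Δ (p i - p i * p i) < ε) ∧
          uniformTraceNorm Δ (1 - ∑ i, p i * p i) < ε ∧
          (∀ i : Fin n, ∀ f ∈ F, ∀ μ ∈ Δ,
            (∫ x, (p i x) ^ 2 * f x ∂(μ : Measure X)) <
              (K / n) * (∫ x, f x ∂(μ : Measure X)) + ε)) :
    SmallBoundaryProperty Δ := by
  obtain ⟨K, hK, hdiv⟩ := hdiv
  have hdense := dense_setOf_measure_zeros_eq_zero (Δ := Δ) fun f η ε hη hε =>
    exists_perturbation_measure_le (fun F hF ε hε n hn => by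
      obtain ⟨p, h01, -, hrest⟩ := hdiv F hF ε hε n hn
      exact ⟨p, h01, hrest⟩) hK f hη hε
  intro x U hU hxU
  obtain ⟨f, hf0, hf1, -⟩ := exists_continuous_zero_one_of_isClosed hU.isClosed_compl
    (isClosed_singleton (x := x)) (by simpa using hxU)
  obtain ⟨g, hg, hgd⟩ := Metric.dense_iff.1 hdense (f - ContinuousMap.const X (1 / 2)) (1 / 2)
    (by norm_num)
  have hclose : ∀ y, |g y - (f y - 1 / 2)| < 1 / 2 := fun y =>
    (ContinuousMap.dist_apply_le_dist (f := g) (g := f - ContinuousMap.const X (1 / 2)) y).trans_lt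
      (Metric.mem_ball.1 hg)
  refine ⟨{y | 0 ≤ g y}, isClosed_le continuous_const g.continuous, ?_, ?_, fun μ hμ => ?_⟩
  · refine interior_maximal (t := {y | 0 < g y}) (fun y (hy : 0 < g y) => hy.le)
      (isOpen_lt continuous_const g.continuous) ?_
    have h1 := (abs_lt.1 (hclose x)).1
    rw [hf1 (Set.mem_singleton x), Pi.one_apply] at h1
    rw [Set.mem_ofPred_eq]
    linarith
  · intro y hy
    by_contra hyU
    have h1 := (abs_lt.1 (hclose y)).2
    rw [hf0 hyU, Pi.zero_apply] at h1
    rw [Set.mem_ofPred_eq] at hy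
    linarith
  · have hnull : (μ : Measure X) (frontier {y | 0 ≤ g y}) = 0 :=
      measure_mono_null
        ((frontier_le_subset_eq continuous_const g.continuous).trans fun y hy => hy.symm)
        (hgd μ hμ)
    simpa using hnull
end

section
/- Let X be a compact metrizable topological space, let f : X → ℝ be continuous, and let ε > 0. Then there exist n ∈ ℕ, δ > 0, and continuous functions f_1, ..., f_n : X → ℝ such that: (1) ‖f − f_i‖_∞ < ε for each i = 1, ..., n; and (2) for every x ∈ X, (1/n) · |{ i ∈ {1, ..., n} : |f_i(x)| < δ }| < ε. In particular, (1/n) · ( ∫_X χ_δ(f_1(x)) dμ(x) + ... + ∫_X χ_δ(f_n(x)) dμ(x) ) < ε for every Borel probability measure μ on X. -/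
open MeasureTheory Filter Topology

/-- The cutoff function `χ_δ : ℝ → [0,1]`: equal to `1` for `|t| ≤ δ/2`, `0` for
`|t| ≥ δ`, and linear in between. -/
noncomputable def chiCutoff (δ t : ℝ) : ℝ :=
  max 0 (min 1 (2 - 2 * |t| / δ))

theorem continuous_chiCutoff (δ : ℝ) : Continuous (chiCutoff δ) := by
  unfold chiCutoff
  fun_prop

theorem chiCutoff_nonneg (δ t : ℝ) : 0 ≤ chiCutoff δ t :=
  le_max_left _ _

theorem chiCutoff_le_one (δ t : ℝ) : chiCutoff δ t ≤ 1 :=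
  max_le zero_le_one (min_le_left _ _)

theorem chiCutoff_eq_zero {δ t : ℝ} (hδ : 0 < δ) (ht : δ ≤ |t|) : chiCutoff δ t = 0 := by
  have h : 1 ≤ |t| / δ := (one_le_div hδ).2 ht
  refine max_eq_left ((min_le_right _ _).trans ?_)
  rw [mul_div_assoc]
  linarith

theorem sum_chiCutoff_le_card {ι : Type*} [Fintype ι] {δ : ℝ} (hδ : 0 < δ) (t : ι → ℝ) :
    ∑ i, chiCutoff δ (t i) ≤ (Nat.card {i : ι // |t i| < δ} : ℝ) := by
  classical
  rw [Nat.card_eq_fintype_card, Fintype.card_subtype, Finset.card_filter]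
  push_cast
  refine Finset.sum_le_sum fun i _ => ?_
  split_ifs with h
  · exact chiCutoff_le_one _ _
  · exact (chiCutoff_eq_zero hδ (not_lt.1 h)).le

/-- Among the translates of a real number by a progression of step `2 * δ`, at most one has
absolute value less than `δ`. -/
theorem card_abs_add_lt_le_one {n : ℕ} {δ : ℝ} (hδ : 0 < δ) (a : ℝ) :
    Nat.card {i : Fin n // |a + 2 * δ * (i : ℕ)| < δ} ≤ 1 := by
  rw [Finite.card_le_one_iff_subsingleton]
  refine ⟨fun ⟨i, hi⟩ ⟨j, hj⟩ => Subtype.ext (Fin.ext ?_)⟩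
  rw [abs_lt] at hi hj
  have hij : ((i : ℕ) : ℝ) < (j : ℕ) + 1 := by
    refine lt_of_mul_lt_mul_left ?_ (by positivity : 0 ≤ 2 * δ)
    linarith
  have hji : ((j : ℕ) : ℝ) < (i : ℕ) + 1 := by
    refine lt_of_mul_lt_mul_left ?_ (by positivity : 0 ≤ 2 * δ)
    linarith
  norm_cast at hij hji
  change (i : ℕ) = j
  omega

theorem sum_integral_chiCutoff_le {X ι : Type*} [Fintype ι] [TopologicalSpace X]
    [MeasurableSpace X] [BorelSpace X] (μ : Measure X) [IsProbabilityMeasure μ]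
    {δ C : ℝ} (hδ : 0 < δ) (fs : ι → C(X, ℝ))
    (hC : ∀ x, (Nat.card {i : ι // |fs i x| < δ} : ℝ) ≤ C) :
    ∑ i, ∫ x, chiCutoff δ (fs i x) ∂μ ≤ C := by
  have hint : ∀ i, Integrable (fun x => chiCutoff δ (fs i x)) μ := fun i =>
    Integrable.of_bound
      ((continuous_chiCutoff δ).comp (fs i).continuous).measurable.aestronglyMeasurable 1
      (ae_of_all _ fun x => by
        rw [Real.norm_of_nonneg (chiCutoff_nonneg _ _)]
        exact chiCutoff_le_one _ _)
  rw [← integral_finsetSum _ fun i _ => hint i]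
  calc ∫ x, ∑ i, chiCutoff δ (fs i x) ∂μ ≤ ∫ _, C ∂μ :=
        integral_mono (integrable_finsetSum _ fun i _ => hint i) (integrable_const C)
          fun x => (sum_chiCutoff_le_card hδ fun i => fs i x).trans (hC x)
    _ = C := by simp

theorem approx_by_functions_with_few_small_values
    {X : Type*} [TopologicalSpace X] [CompactSpace X] [TopologicalSpace.MetrizableSpace X]
    [MeasurableSpace X] [BorelSpace X]
    (f : C(X, ℝ)) (ε : ℝ) (hε : 0 < ε) :
    ∃ (n : ℕ) (_ : 0 < n) (δ : ℝ) (_ : 0 < δ) (fs : Fin n → C(X, ℝ)),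
      (∀ i, ‖f - fs i‖ < ε) ∧
      (∀ x : X, ((Nat.card {i : Fin n // |fs i x| < δ}) : ℝ) / n < ε) ∧
      (∀ μ : ProbabilityMeasure X,
        (1 / n : ℝ) * (∑ i, ∫ x, chiCutoff δ (fs i x) ∂(μ : Measure X)) < ε) := by
  obtain ⟨m, hm⟩ := exists_nat_one_div_lt hε
  obtain ⟨n, hn, hnε⟩ : ∃ n : ℕ, 0 < n ∧ (1 / n : ℝ) < ε :=
    ⟨m + 1, m.succ_pos, by exact_mod_cast hm⟩
  have hn' : (0 : ℝ) < n := by exact_mod_cast hn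
  have hδ : 0 < ε / (2 * n) := by positivity
  have hcard : ∀ x : X, (Nat.card {i : Fin n //
      |(f + ContinuousMap.const X (2 * (ε / (2 * n)) * (i : ℕ))) x| < ε / (2 * n)} : ℝ) ≤ 1 :=
    fun x => by exact_mod_cast card_abs_add_lt_le_one hδ (f x)
  refine ⟨n, hn, ε / (2 * n), hδ,
    fun i => f + ContinuousMap.const X (2 * (ε / (2 * n)) * (i : ℕ)),
    fun i => ?_, fun x => ?_, fun μ => ?_⟩
  · rw [ContinuousMap.norm_lt_iff _ hε]
    intro x
    have hi : ((i : ℕ) : ℝ) < n := by exact_mod_cast i.isLt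
    have hstep : 2 * (ε / (2 * n)) * (i : ℕ) = ε * ((i : ℕ) / n) := by field_simp
    have hnonneg : 0 ≤ ε * ((i : ℕ) / n : ℝ) := by positivity
    rw [sub_add_cancel_left, ContinuousMap.neg_apply, norm_neg, ContinuousMap.const_apply, hstep,
      Real.norm_of_nonneg hnonneg]
    exact mul_lt_of_lt_one_right hε ((div_lt_one hn').2 hi)
  · exact (div_le_div_of_nonneg_right (hcard x) hn'.le).trans_lt hnε
  · exact (mul_le_of_le_one_right (by positivity)
      (sum_integral_chiCutoff_le (μ : Measure X) hδ _ hcard)).trans_lt hnε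
end

section
/- Let X be a compact metrizable topological space, let Δ be a weak-*-closed convex set of Borel probability measures on X whose set ∂Δ of extreme points is compact, and let ω be a free ultrafilter on ℕ. Let (c_k) be a sequence of continuous functions X → [0,1], and assume Δ is ample with respect to (c_k), meaning: for every sequence (μ_k) in Δ, setting L = lim_{k→ω} ∫_X c_k dμ_k, (a) if L ≠ 0 then there exists ν ∈ Δ such that ∫_X f dν = (1/L) · lim_{k→ω} ∫_X f · c_k dμ_k for all continuous f : X → ℝ, and (b) if L ≠ 1 then there exists ν' ∈ Δ such that ∫_X f dν' = (1/(1−L)) · lim_{k→ω} ∫_X f · (1 − c_k) dμ_k for all continuous f : X → ℝ. Then for every continuous f : X → ℝ, lim_{k→ω} sup_{μ∈∂Δ} | ∫_X f·c_k dμ − (∫_X f dμ)(∫_X c_k dμ) | = 0. -/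
open MeasureTheory Filter Topology
open scoped NNReal ENNReal

/-- `μ` is an extreme point of the set `Δ` of probability measures: it belongs to `Δ` and
cannot be written as a nontrivial convex combination `t μ₁ + (1 - t) μ₂` of two distinct
members of `Δ`. -/
def IsExtremePointOf {X : Type*} [TopologicalSpace X] [MeasurableSpace X]
    (Δ : Set (ProbabilityMeasure X)) (μ : ProbabilityMeasure X) : Prop :=
  μ ∈ Δ ∧ ∀ μ₁ ∈ Δ, ∀ μ₂ ∈ Δ, ∀ t : ℝ≥0, 0 < t → t < 1 →
    (μ : Measure X) = t • (μ₁ : Measure X) + (1 - t) • (μ₂ : Measure X) → μ₁ = μ₂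

namespace MeasureTheory.ProbabilityMeasure

variable {X : Type*} [TopologicalSpace X] [MeasurableSpace X] [BorelSpace X]

/-- An identity `μ = t ν + (1 - t) ν'` may be tested on integrals of continuous functions. -/
lemma eq_convexCombination_of_integral [HasOuterApproxClosed X] (μ ν ν' : ProbabilityMeasure X)
    (t : ℝ≥0) (ht : t ≤ 1)
    (h : ∀ f : C(X, ℝ), ∫ x, f x ∂(μ : Measure X) =
      t * ∫ x, f x ∂(ν : Measure X) + (1 - t) * ∫ x, f x ∂(ν' : Measure X)) :
    (μ : Measure X) = t • (ν : Measure X) + (1 - t) • (ν' : Measure X) := by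
  refine ext_of_forall_integral_eq_of_IsFiniteMeasure fun f => ?_
  have h1 := h f.toContinuousMap
  rw [integral_add_measure ((f.integrable _).smul_measure_nnreal)
    ((f.integrable _).smul_measure_nnreal), integral_smul_nnreal_measure,
    integral_smul_nnreal_measure]
  simpa [NNReal.smul_def, NNReal.coe_sub ht] using h1

variable [CompactSpace X]

lemma integrable_continuousMap (μ : ProbabilityMeasure X) (g : C(X, ℝ)) :
    Integrable g (μ : Measure X) :=
  (BoundedContinuousFunction.mkOfCompact g).integrable (μ : Measure X)

lemma tendsto_integral_continuousMap {ι : Type*} {l : Filter ι}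
    {μs : ι → ProbabilityMeasure X} {μ : ProbabilityMeasure X}
    (h : Tendsto μs l (𝓝 μ)) (g : C(X, ℝ)) :
    Tendsto (fun k => ∫ x, g x ∂(μs k : Measure X)) l (𝓝 (∫ x, g x ∂(μ : Measure X))) :=
  (ProbabilityMeasure.tendsto_iff_forall_integral_tendsto.1 h)
    (BoundedContinuousFunction.mkOfCompact g)

/-- If `∫ c_k dμ_k → 0` with `c_k ≥ 0`, then `∫ f c_k dμ_k → 0`. -/
lemma tendsto_integral_mul_zero {l : Filter ℕ} (μs : ℕ → ProbabilityMeasure X)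
    (c : ℕ → C(X, ℝ)) (hc : ∀ k x, 0 ≤ c k x) (f : C(X, ℝ))
    (h : Tendsto (fun k => ∫ x, c k x ∂(μs k : Measure X)) l (𝓝 0)) :
    Tendsto (fun k => ∫ x, f x * c k x ∂(μs k : Measure X)) l (𝓝 0) := by
  refine squeeze_zero_norm (fun k => ?_) (by simpa using h.const_mul ‖f‖)
  rw [← integral_const_mul]
  refine norm_integral_le_of_norm_le ((integrable_continuousMap _ _).const_mul _)
    (.of_forall fun x => ?_)
  rw [norm_mul, Real.norm_of_nonneg (hc k x)]
  exact mul_le_mul_of_nonneg_right (f.norm_coe_le_norm x) (hc k x)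

end MeasureTheory.ProbabilityMeasure

/-- Along any sequence of extreme points, the covariance of `f` and `c_k` tends to zero. -/
theorem tendsto_covariance_of_extreme
    {X : Type*} [TopologicalSpace X] [CompactSpace X] [HasOuterApproxClosed X]
    [MeasurableSpace X] [BorelSpace X]
    (Δ : Set (ProbabilityMeasure X))
    (hext : IsCompact {μ : ProbabilityMeasure X | IsExtremePointOf Δ μ})
    (ω : Ultrafilter ℕ)
    (c : ℕ → C(X, ℝ)) (hc : ∀ k x, c k x ∈ Set.Icc (0 : ℝ) 1)
    (hample : ∀ μs : ℕ → ProbabilityMeasure X, (∀ k, μs k ∈ Δ) →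
      ∀ L : ℝ, Tendsto (fun k => ∫ x, c k x ∂(μs k : Measure X)) (ω : Filter ℕ) (nhds L) →
        (L ≠ 0 → ∃ ν ∈ Δ, ∀ f : C(X, ℝ),
          Tendsto (fun k => ∫ x, f x * c k x ∂(μs k : Measure X)) (ω : Filter ℕ)
            (nhds (L * ∫ x, f x ∂(ν : Measure X)))) ∧
        (L ≠ 1 → ∃ ν' ∈ Δ, ∀ f : C(X, ℝ),
          Tendsto (fun k => ∫ x, f x * (1 - c k x) ∂(μs k : Measure X)) (ω : Filter ℕ)
            (nhds ((1 - L) * ∫ x, f x ∂(ν' : Measure X)))))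
    (f : C(X, ℝ)) (μs : ℕ → ProbabilityMeasure X) (hμs : ∀ k, IsExtremePointOf Δ (μs k)) :
    Tendsto (fun k => (∫ x, f x * c k x ∂(μs k : Measure X)) -
        (∫ x, f x ∂(μs k : Measure X)) * (∫ x, c k x ∂(μs k : Measure X)))
      (ω : Filter ℕ) (𝓝 0) := by
  obtain ⟨μ, hμ, hlim⟩ := hext.ultrafilter_le_nhds (ω.map μs)
    (le_principal_iff.2 (Filter.Eventually.of_forall hμs : ∀ᶠ k in (ω : Filter ℕ), _))
  replace hlim : Tendsto μs ω (𝓝 μ) := hlim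
  have hmem : ∀ k, ∫ x, c k x ∂(μs k : Measure X) ∈ Set.Icc (0 : ℝ) 1 := fun k => by
    refine ⟨integral_nonneg fun x => (hc k x).1, ?_⟩
    simpa using integral_mono (ProbabilityMeasure.integrable_continuousMap (μs k) (c k))
      (integrable_const (1 : ℝ)) fun x => (hc k x).2
  obtain ⟨L, hL, hLlim⟩ := (isCompact_Icc (a := (0 : ℝ)) (b := 1)).ultrafilter_le_nhds
    (ω.map fun k => ∫ x, c k x ∂(μs k : Measure X))
    (le_principal_iff.2 (Filter.Eventually.of_forall hmem : ∀ᶠ k in (ω : Filter ℕ), _))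
  replace hLlim : Tendsto (fun k => ∫ x, c k x ∂(μs k : Measure X)) ω (𝓝 L) := hLlim
  have hf := fun g => ProbabilityMeasure.tendsto_integral_continuousMap hlim g
  have hsplit : ∀ (g : C(X, ℝ)) k, ∫ x, g x * (1 - c k x) ∂(μs k : Measure X) =
      ∫ x, g x ∂(μs k : Measure X) - ∫ x, g x * c k x ∂(μs k : Measure X) := fun g k => by
    simpa [mul_sub] using integral_sub (ProbabilityMeasure.integrable_continuousMap (μs k) g)
      (ProbabilityMeasure.integrable_continuousMap (μs k) (g * c k))
  suffices h : Tendsto (fun k => ∫ x, f x * c k x ∂(μs k : Measure X)) ω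
      (𝓝 ((∫ x, f x ∂(μ : Measure X)) * L)) by
    simpa using h.sub ((hf f).mul hLlim)
  by_cases h0 : L = 0
  · subst h0
    simpa using ProbabilityMeasure.tendsto_integral_mul_zero μs c (fun k x => (hc k x).1) f hLlim
  by_cases h1 : L = 1
  · subst h1
    have hone : ∀ k, ∫ x, (1 - c k x) ∂(μs k : Measure X) =
        1 - ∫ x, c k x ∂(μs k : Measure X) := fun k => by simpa using hsplit 1 k
    have h := ProbabilityMeasure.tendsto_integral_mul_zero (l := ω) μs (fun k => 1 - c k)
      (fun k x => by simpa using (hc k x).2) f (by simpa [hone] using hLlim.const_sub 1)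
    simpa [hsplit] using (hf f).sub h
  obtain ⟨h₁, h₂⟩ := hample μs (fun k => (hμs k).1) L hLlim
  obtain ⟨ν, hν, hνlim⟩ := h₁ h0
  obtain ⟨ν', hν', hν'lim⟩ := h₂ h1
  have hcomb : ∀ g : C(X, ℝ), ∫ x, g x ∂(μ : Measure X) =
      L * ∫ x, g x ∂(ν : Measure X) + (1 - L) * ∫ x, g x ∂(ν' : Measure X) := fun g =>
    tendsto_nhds_unique (hf g) (by simpa [hsplit] using (hνlim g).add (hν'lim g))
  lift L to ℝ≥0 using hL.1
  have heq : ν = ν' := hμ.2 ν hν ν' hν' L (pos_iff_ne_zero.2 (by exact_mod_cast h0))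
    (lt_of_le_of_ne (by exact_mod_cast hL.2) (by exact_mod_cast h1))
    (ProbabilityMeasure.eq_convexCombination_of_integral μ ν ν' L (by exact_mod_cast hL.2) hcomb)
  convert hνlim f using 2
  rw [hcomb f, ← heq]
  ring


theorem ample_extreme_condition
    {X : Type*} [TopologicalSpace X] [CompactSpace X] [TopologicalSpace.MetrizableSpace X]
    [MeasurableSpace X] [BorelSpace X]
    (Δ : Set (ProbabilityMeasure X)) (hΔclosed : IsClosed Δ)
    (hΔconv : ∀ μ₁ ∈ Δ, ∀ μ₂ ∈ Δ, ∀ t : ℝ≥0, t ≤ 1 → ∀ ν : ProbabilityMeasure X,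
      (ν : Measure X) = t • (μ₁ : Measure X) + (1 - t) • (μ₂ : Measure X) → ν ∈ Δ)
    (hext : IsCompact {μ : ProbabilityMeasure X | IsExtremePointOf Δ μ})
    (ω : Ultrafilter ℕ) (hω : (ω : Filter ℕ) ≤ Filter.cofinite)
    (c : ℕ → C(X, ℝ)) (hc : ∀ k x, c k x ∈ Set.Icc (0 : ℝ) 1)
    (hample : ∀ μs : ℕ → ProbabilityMeasure X, (∀ k, μs k ∈ Δ) →
      ∀ L : ℝ, Tendsto (fun k => ∫ x, c k x ∂(μs k : Measure X)) (ω : Filter ℕ) (nhds L) →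
        (L ≠ 0 → ∃ ν ∈ Δ, ∀ f : C(X, ℝ),
          Tendsto (fun k => ∫ x, f x * c k x ∂(μs k : Measure X)) (ω : Filter ℕ)
            (nhds (L * ∫ x, f x ∂(ν : Measure X)))) ∧
        (L ≠ 1 → ∃ ν' ∈ Δ, ∀ f : C(X, ℝ),
          Tendsto (fun k => ∫ x, f x * (1 - c k x) ∂(μs k : Measure X)) (ω : Filter ℕ)
            (nhds ((1 - L) * ∫ x, f x ∂(ν' : Measure X))))) :
    ∀ f : C(X, ℝ),
      Tendsto
        (fun k => ⨆ μ ∈ {μ : ProbabilityMeasure X | IsExtremePointOf Δ μ},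
          |(∫ x, f x * c k x ∂(μ : Measure X)) -
            (∫ x, f x ∂(μ : Measure X)) * (∫ x, c k x ∂(μ : Measure X))|)
        (ω : Filter ℕ) (nhds 0) := by
  intro f
  set E := {μ : ProbabilityMeasure X | IsExtremePointOf Δ μ}
  set D : ℕ → ProbabilityMeasure X → ℝ := fun k μ => (∫ x, f x * c k x ∂(μ : Measure X)) -
    (∫ x, f x ∂(μ : Measure X)) * (∫ x, c k x ∂(μ : Measure X))
  rw [Metric.tendsto_nhds]
  intro ε hε
  have hsmall : ∀ᶠ k in (ω : Filter ℕ), ∀ μ ∈ E, |D k μ| < ε / 2 := by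
    rcases E.eq_empty_or_nonempty with hE | ⟨μ₀, hμ₀⟩
    · simp [hE]
    have hchoose : ∀ k, ∃ μ ∈ E, (∃ μ' ∈ E, ε / 2 ≤ |D k μ'|) → ε / 2 ≤ |D k μ| := fun k => by
      by_cases h : ∃ μ' ∈ E, ε / 2 ≤ |D k μ'|
      · obtain ⟨μ', hμ', h'⟩ := h
        exact ⟨μ', hμ', fun _ => h'⟩
      · exact ⟨μ₀, hμ₀, fun h' => absurd h' h⟩
    choose μs hμs hmax using hchoose
    have hlim := tendsto_covariance_of_extreme Δ hext ω c hc hample f μs hμs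
    filter_upwards [Metric.tendsto_nhds.1 hlim (ε / 2) (half_pos hε)] with k hk
    rw [Real.dist_0_eq_abs] at hk
    by_contra! hcon
    exact (hmax k hcon).not_gt hk
  filter_upwards [hsmall] with k hk
  have hle : ⨆ μ ∈ E, |D k μ| ≤ ε / 2 :=
    Real.iSup_le (fun μ => Real.iSup_le (fun hμ => (hk μ hμ).le) (half_pos hε).le)
      (half_pos hε).le
  rw [Real.dist_0_eq_abs, abs_of_nonneg
    (Real.iSup_nonneg fun μ => Real.iSup_nonneg fun _ => abs_nonneg _)]
  exact hle.trans_lt (half_lt_self hε)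
end

section
/- Let X be a compact metrizable topological space, let Δ be a weak-*-closed convex set of Borel probability measures on X whose set ∂Δ of extreme points is compact, and let ω be a free ultrafilter on ℕ. Let n ∈ ℕ and for each i = 1, ..., n let (p_{i,k})_{k∈ℕ} be a sequence of continuous functions X → [0,1] such that: (1) lim_{k→ω} sup_{μ∈Δ} ∫ (p_{i,k} p_{j,k})² dμ = 0 for all i ≠ j; (2) lim_{k→ω} sup_{μ∈Δ} ∫ (p_{i,k} − p_{i,k}²)² dμ = 0 for each i; (3) lim_{k→ω} sup_{μ∈Δ} ∫ (1 − (p_{1,k} + ... + p_{n,k}))² dμ = 0; (4) for each i and every sequence (μ_k) in Δ, lim_{k→ω} ∫ p_{i,k} dμ_k = 1/n; and (5) Δ is ample with respect to each (p_{i,k})_k, i.e. for every sequence (μ_k) in Δ, setting L = lim_{k→ω} ∫ p_{i,k} dμ_k, if L ≠ 0 there is ν ∈ Δ with ∫ f dν = (1/L)·lim_{k→ω} ∫ f·p_{i,k} dμ_k for all continuous f : X → ℝ, and if L ≠ 1 there is ν' ∈ Δ with ∫ f dν' = (1/(1−L))·lim_{k→ω} ∫ f·(1 − p_{i,k}) dμ_k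 for all continuous f : X → ℝ. Then for every continuous f : X → ℝ, every i = 1, ..., n, and every sequence (μ_k) in Δ: lim_{k→ω} ∫_X p_{i,k}² f dμ_k = (1/n) · lim_{k→ω} ∫_X f dμ_k. -/
open MeasureTheory Filter Topology
open scoped NNReal ENNReal

lemma MeasureTheory.ProbabilityMeasure.toMeasure_eq_of_forall_integral_eq {X : Type*}
    [TopologicalSpace X] [MeasurableSpace X] [BorelSpace X] [HasOuterApproxClosed X]
    (μ : ProbabilityMeasure X) (ν : Measure X) [IsFiniteMeasure ν]
    (h : ∀ f : C(X, ℝ), ∫ x, f x ∂(μ : Measure X) = ∫ x, f x ∂ν) : (μ : Measure X) = ν :=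
  ext_of_forall_integral_eq_of_IsFiniteMeasure fun f => h f.toContinuousMap

section ProbabilityMeasuresOnCompactSpaces

variable {X : Type*} [TopologicalSpace X] [CompactSpace X] [MeasurableSpace X] [BorelSpace X]

lemma ContinuousMap.integrable_of_isFiniteMeasure (f : C(X, ℝ)) (μ : Measure X)
    [IsFiniteMeasure μ] : Integrable (fun x => f x) μ :=
  (BoundedContinuousFunction.mkOfCompact f).integrable μ

lemma ContinuousMap.continuous_integral_probabilityMeasure (f : C(X, ℝ)) :
    Continuous fun μ : ProbabilityMeasure X => ∫ x, f x ∂(μ : Measure X) :=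
  ProbabilityMeasure.continuous_integral_boundedContinuousFunction
    (BoundedContinuousFunction.mkOfCompact f)

lemma integral_nnreal_convexCombination (f : C(X, ℝ)) (μ₁ μ₂ : ProbabilityMeasure X) {t : ℝ≥0}
    (ht : t ≤ 1) :
    ∫ x, f x ∂(t • (μ₁ : Measure X) + (1 - t) • (μ₂ : Measure X)) =
      t * ∫ x, f x ∂(μ₁ : Measure X) + (1 - t) * ∫ x, f x ∂(μ₂ : Measure X) := by
  rw [integral_add_measure (f.integrable_of_isFiniteMeasure _) (f.integrable_of_isFiniteMeasure _),
    integral_smul_nnreal_measure, integral_smul_nnreal_measure]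
  simp [NNReal.smul_def, NNReal.coe_sub ht]

lemma abs_integral_mul_le_norm_mul_integral_abs (f h : C(X, ℝ)) (μ : Measure X)
    [IsFiniteMeasure μ] : |∫ x, h x * f x ∂μ| ≤ ‖f‖ * ∫ x, |h x| ∂μ := by
  rw [← integral_const_mul]
  refine abs_integral_le_integral_abs.trans (integral_mono ?_ ?_ fun x => ?_)
  · exact |h * f|.integrable_of_isFiniteMeasure μ
  · exact (‖f‖ • |h|).integrable_of_isFiniteMeasure μ
  · simp only [abs_mul]
    rw [mul_comm]
    exact mul_le_mul_of_nonneg_right (f.norm_coe_le_norm x) (abs_nonneg _)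

lemma sq_integral_le_integral_sq (h : C(X, ℝ)) (μ : Measure X) [IsProbabilityMeasure μ] :
    (∫ x, h x ∂μ) ^ 2 ≤ ∫ x, h x ^ 2 ∂μ :=
  (even_two.convexOn_pow (𝕜 := ℝ)).map_integral_le (by fun_prop) isClosed_univ (by simp)
    (h.integrable_of_isFiniteMeasure μ) ((h ^ 2).integrable_of_isFiniteMeasure μ)

/-- If `h k` tends to zero in quadratic mean, then so does its integral against a fixed continuous
function. -/
lemma tendsto_integral_mul_of_tendsto_integral_sq {ι : Type*} {l : Filter ι} {h : ι → C(X, ℝ)}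
    {μ : ι → ProbabilityMeasure X}
    (hh : Tendsto (fun k => ∫ x, h k x ^ 2 ∂(μ k : Measure X)) l (𝓝 0)) (f : C(X, ℝ)) :
    Tendsto (fun k => ∫ x, h k x * f x ∂(μ k : Measure X)) l (𝓝 0) := by
  have hsqrt : Tendsto (fun k => ‖f‖ * √(∫ x, h k x ^ 2 ∂(μ k : Measure X))) l (𝓝 0) := by
    simpa using hh.sqrt.const_mul ‖f‖
  refine squeeze_zero_norm (fun k => ?_) hsqrt
  refine (abs_integral_mul_le_norm_mul_integral_abs f (h k) (μ k)).trans ?_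
  refine mul_le_mul_of_nonneg_left (Real.le_sqrt_of_sq_le ?_) (norm_nonneg f)
  simpa using sq_integral_le_integral_sq |h k| (μ k : Measure X)

lemma integral_le_biSup_integral {Δ : Set (ProbabilityMeasure X)} (h : C(X, ℝ))
    {μ : ProbabilityMeasure X} (hμ : μ ∈ Δ) :
    ∫ x, h x ∂(μ : Measure X) ≤ ⨆ ν ∈ Δ, ∫ x, h x ∂(ν : Measure X) := by
  have hle (ν : ProbabilityMeasure X) : ∫ x, h x ∂(ν : Measure X) ≤ ‖h‖ := by
    refine (integral_mono (h.integrable_of_isFiniteMeasure _) (integrable_const ‖h‖)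
      fun x => (le_abs_self _).trans (h.norm_coe_le_norm x)).trans_eq ?_
    simp
  refine le_ciSup_of_le ⟨‖h‖, ?_⟩ μ ?_
  · rintro _ ⟨ν, rfl⟩
    exact Real.iSup_le (fun _ => hle ν) (norm_nonneg h)
  · simp [hμ]

variable [TopologicalSpace.MetrizableSpace X]

/-- A continuous function attains its maximal integral over a nonempty closed set of probability
measures at an extreme point. -/
lemma exists_isExtremePointOf_forall_integral_le {Δ : Set (ProbabilityMeasure X)}
    (hΔ : IsClosed Δ) (hne : Δ.Nonempty) (g : C(X, ℝ)) :
    ∃ ν, IsExtremePointOf Δ ν ∧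
      ∀ μ ∈ Δ, ∫ x, g x ∂(μ : Measure X) ≤ ∫ x, g x ∂(ν : Measure X) := by
  let Φ : ProbabilityMeasure X → C(X, ℝ) → ℝ := fun μ f => ∫ x, f x ∂(μ : Measure X)
  have hΦ : Continuous Φ :=
    continuous_pi fun f => f.continuous_integral_probabilityMeasure
  have hΦinj : Function.Injective Φ := fun μ ν h =>
    Subtype.ext (ProbabilityMeasure.toMeasure_eq_of_forall_integral_eq μ ν (congrFun h))
  have hK : IsCompact (Φ '' Δ) := hΔ.isCompact.image hΦ
  let ℓ : (C(X, ℝ) → ℝ) →L[ℝ] ℝ := ContinuousLinearMap.proj g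
  have hexp : IsExposed ℝ (Φ '' Δ) {y ∈ Φ '' Δ | ∀ z ∈ Φ '' Δ, ℓ z ≤ ℓ y} :=
    fun _ => ⟨ℓ, rfl⟩
  obtain ⟨y, hyK, hymax⟩ := hK.exists_isMaxOn (hne.image Φ) ℓ.continuous.continuousOn
  obtain ⟨e, he⟩ := (hexp.isCompact hK).extremePoints_nonempty ⟨y, hyK, fun z hz => hymax hz⟩
  obtain ⟨⟨ν, hνΔ, rfl⟩, hmax⟩ := extremePoints_subset he
  have hext := (mem_extremePoints.1 (hexp.isExtreme.extremePoints_subset_extremePoints he)).2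
  refine ⟨ν, ⟨hνΔ, fun μ₁ h₁ μ₂ h₂ t ht0 ht1 heq => ?_⟩, fun μ hμ => hmax _ ⟨μ, hμ, rfl⟩⟩
  obtain ⟨e₁, e₂⟩ := hext (Φ μ₁) ⟨μ₁, h₁, rfl⟩ (Φ μ₂) ⟨μ₂, h₂, rfl⟩
    ⟨t, 1 - t, by exact_mod_cast ht0, by simpa using ht1, by ring, by
      funext f
      simp only [Φ, heq, integral_nnreal_convexCombination f μ₁ μ₂ ht1.le, Pi.add_apply,
        Pi.smul_apply, smul_eq_mul]⟩
  exact hΦinj (e₁.trans e₂.symm)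

/-- Integrals of a sequence of continuous functions tend to zero along every sequence of measures
in `Δ` if they do so along every sequence of extreme points. -/
lemma tendsto_integral_zero_of_forall_isExtremePointOf {Δ : Set (ProbabilityMeasure X)}
    (hΔ : IsClosed Δ) {ι : Type*} {l : Filter ι} (g : ι → C(X, ℝ))
    (hg : ∀ ν : ι → ProbabilityMeasure X, (∀ k, IsExtremePointOf Δ (ν k)) →
      Tendsto (fun k => ∫ x, g k x ∂(ν k : Measure X)) l (𝓝 0))
    {μ : ι → ProbabilityMeasure X} (hμ : ∀ k, μ k ∈ Δ) :
    Tendsto (fun k => ∫ x, g k x ∂(μ k : Measure X)) l (𝓝 0) := by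
  choose a ha hamax using fun k =>
    exists_isExtremePointOf_forall_integral_le hΔ ⟨μ k, hμ k⟩ (g k)
  choose b hb hbmax using fun k =>
    exists_isExtremePointOf_forall_integral_le hΔ ⟨μ k, hμ k⟩ (-g k)
  refine tendsto_of_tendsto_of_tendsto_of_le_of_le (hg b hb) (hg a ha) (fun k => ?_)
    fun k => hamax k _ (hμ k)
  simpa [integral_neg] using hbmax k _ (hμ k)

/-- If an extreme point agrees, on continuous functions, with a nontrivial convex combination of
two members of `Δ`, then it has the same integrals as the first of them. -/
lemma IsExtremePointOf.integral_eq_of_convexCombination {Δ : Set (ProbabilityMeasure X)}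
    {μ ν ν' : ProbabilityMeasure X} (hμ : IsExtremePointOf Δ μ) (hν : ν ∈ Δ) (hν' : ν' ∈ Δ)
    {t : ℝ} (ht0 : 0 < t) (ht1 : t < 1)
    (h : ∀ f : C(X, ℝ), ∫ x, f x ∂(μ : Measure X) =
      t * ∫ x, f x ∂(ν : Measure X) + (1 - t) * ∫ x, f x ∂(ν' : Measure X)) (f : C(X, ℝ)) :
    ∫ x, f x ∂(μ : Measure X) = ∫ x, f x ∂(ν : Measure X) := by
  lift t to ℝ≥0 using ht0.le
  have ht1' : t < 1 := by exact_mod_cast ht1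
  have heq : ν = ν' := hμ.2 ν hν ν' hν' t (by exact_mod_cast ht0) ht1' <|
    ProbabilityMeasure.toMeasure_eq_of_forall_integral_eq _ _ fun f => by
      rw [h f, integral_nnreal_convexCombination f ν ν' ht1'.le]
  rw [h f, ← heq]
  ring

/-- If `Δ` has compact extreme boundary and is ample with respect to `(p k)`, and `p k` has trace
`t` in the limit, then multiplying by `p k` scales every limit trace of extreme points by `t`. -/
lemma tendsto_integral_mul_sub_of_isExtremePointOf {Δ : Set (ProbabilityMeasure X)}
    (hext : IsCompact {μ : ProbabilityMeasure X | IsExtremePointOf Δ μ})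
    {ι : Type*} (ω : Ultrafilter ι) {p : ι → C(X, ℝ)} (hp : ∀ k x, p k x ≤ 1)
    {μ : ι → ProbabilityMeasure X} (hμ : ∀ k, IsExtremePointOf Δ (μ k)) {t : ℝ}
    (ht0 : 0 < t) (ht1 : t ≤ 1)
    (htrace : Tendsto (fun k => ∫ x, p k x ∂(μ k : Measure X)) ω (𝓝 t))
    (hν : ∃ ν ∈ Δ, ∀ f : C(X, ℝ), Tendsto (fun k => ∫ x, f x * p k x ∂(μ k : Measure X)) ω
      (𝓝 (t * ∫ x, f x ∂(ν : Measure X))))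
    (hν' : t ≠ 1 → ∃ ν' ∈ Δ, ∀ f : C(X, ℝ),
      Tendsto (fun k => ∫ x, f x * (1 - p k x) ∂(μ k : Measure X)) ω
        (𝓝 ((1 - t) * ∫ x, f x ∂(ν' : Measure X)))) (f : C(X, ℝ)) :
    Tendsto (fun k => ∫ x, (p k x - t) * f x ∂(μ k : Measure X)) ω (𝓝 0) := by
  rcases ht1.eq_or_lt with rfl | ht1
  · have hone : Tendsto (fun k => ‖f‖ * (1 - ∫ x, p k x ∂(μ k : Measure X))) ω (𝓝 0) := by
      simpa using (htrace.const_sub 1).const_mul ‖f‖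
    refine squeeze_zero_norm (fun k => ?_) hone
    refine (abs_integral_mul_le_norm_mul_integral_abs f (p k - 1) (μ k)).trans_eq ?_
    have habs : ∀ x, |(p k - 1) x| = 1 - p k x := fun x => by
      rw [abs_of_nonpos (by simpa using hp k x)]
      simp
    simp_rw [habs]
    rw [integral_sub (integrable_const _) ((p k).integrable_of_isFiniteMeasure _)]
    simp
  · obtain ⟨ν, hνΔ, hν⟩ := hν
    obtain ⟨ν', hν'Δ, hν'⟩ := hν' ht1.ne
    obtain ⟨μ₀, hμ₀, hlim⟩ := hext.ultrafilter_le_nhds (ω.map μ)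
      (tendsto_principal.2 (Eventually.of_forall hμ))
    have hμlim (f : C(X, ℝ)) : Tendsto (fun k => ∫ x, f x ∂(μ k : Measure X)) ω
        (𝓝 (∫ x, f x ∂(μ₀ : Measure X))) :=
      (f.continuous_integral_probabilityMeasure.tendsto μ₀).comp hlim
    have hμ₀ν := IsExtremePointOf.integral_eq_of_convexCombination hμ₀ hνΔ hν'Δ ht0 ht1
      (fun f => tendsto_nhds_unique (hμlim f) (((hν f).add (hν' f)).congr fun k =>
        (integral_add ((f * p k).integrable_of_isFiniteMeasure (μ k : Measure X))
          ((f * (1 - p k)).integrable_of_isFiniteMeasure _)).symm.trans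
        (integral_congr_ae (Eventually.of_forall fun x => by simp [mul_sub]))))
    have hdiff := (hν f).sub ((hμlim f).const_mul t)
    rw [hμ₀ν f, sub_self] at hdiff
    refine hdiff.congr fun k => ?_
    rw [← integral_const_mul]
    refine (integral_sub ((f * p k).integrable_of_isFiniteMeasure (μ k : Measure X))
      ((t • f).integrable_of_isFiniteMeasure _)).symm.trans
      (integral_congr_ae (Eventually.of_forall fun x => ?_))
    simp only [ContinuousMap.mul_apply, ContinuousMap.smul_apply, smul_eq_mul]
    ring

end ProbabilityMeasuresOnCompactSpaces

theorem bauer_partition_of_unity_uniform_division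
    {X : Type*} [TopologicalSpace X] [CompactSpace X] [TopologicalSpace.MetrizableSpace X]
    [MeasurableSpace X] [BorelSpace X]
    (Δ : Set (ProbabilityMeasure X)) (hΔclosed : IsClosed Δ)
    (hΔconv : ∀ μ₁ ∈ Δ, ∀ μ₂ ∈ Δ, ∀ t : ℝ≥0, t ≤ 1 → ∀ ν : ProbabilityMeasure X,
      (ν : Measure X) = t • (μ₁ : Measure X) + (1 - t) • (μ₂ : Measure X) → ν ∈ Δ)
    (hext : IsCompact {μ : ProbabilityMeasure X | IsExtremePointOf Δ μ})
    (ω : Ultrafilter ℕ) (hω : (ω : Filter ℕ) ≤ Filter.cofinite)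
    (n : ℕ) (hn : 0 < n) (p : Fin n → ℕ → C(X, ℝ))
    (hp01 : ∀ i k x, p i k x ∈ Set.Icc (0 : ℝ) 1)
    (horth : ∀ i j, i ≠ j →
      Tendsto (fun k => ⨆ μ ∈ Δ, ∫ x, (p i k x * p j k x) ^ 2 ∂(μ : Measure X))
        (ω : Filter ℕ) (nhds 0))
    (hproj : ∀ i,
      Tendsto (fun k => ⨆ μ ∈ Δ, ∫ x, (p i k x - (p i k x) ^ 2) ^ 2 ∂(μ : Measure X))
        (ω : Filter ℕ) (nhds 0))
    (hsum : Tendsto (fun k => ⨆ μ ∈ Δ, ∫ x, (1 - ∑ i, p i k x) ^ 2 ∂(μ : Measure X))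
        (ω : Filter ℕ) (nhds 0))
    (htrace : ∀ (i : Fin n) (μs : ℕ → ProbabilityMeasure X), (∀ k, μs k ∈ Δ) →
      Tendsto (fun k => ∫ x, p i k x ∂(μs k : Measure X)) (ω : Filter ℕ)
        (nhds (1 / (n : ℝ))))
    (hample : ∀ (i : Fin n) (μs : ℕ → ProbabilityMeasure X), (∀ k, μs k ∈ Δ) →
      ∀ L : ℝ, Tendsto (fun k => ∫ x, p i k x ∂(μs k : Measure X)) (ω : Filter ℕ) (nhds L) →
        (L ≠ 0 → ∃ ν ∈ Δ, ∀ f : C(X, ℝ),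
          Tendsto (fun k => ∫ x, f x * p i k x ∂(μs k : Measure X)) (ω : Filter ℕ)
            (nhds (L * ∫ x, f x ∂(ν : Measure X)))) ∧
        (L ≠ 1 → ∃ ν' ∈ Δ, ∀ f : C(X, ℝ),
          Tendsto (fun k => ∫ x, f x * (1 - p i k x) ∂(μs k : Measure X)) (ω : Filter ℕ)
            (nhds ((1 - L) * ∫ x, f x ∂(ν' : Measure X))))) :
    ∀ (f : C(X, ℝ)) (i : Fin n) (μs : ℕ → ProbabilityMeasure X), (∀ k, μs k ∈ Δ) →
      ∀ L : ℝ, Tendsto (fun k => ∫ x, f x ∂(μs k : Measure X)) (ω : Filter ℕ) (nhds L) →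
        Tendsto (fun k => ∫ x, (p i k x) ^ 2 * f x ∂(μs k : Measure X)) (ω : Filter ℕ)
          (nhds (L / n)) := by
  intro f i μs hμs L hL
  have hn1 : (1 : ℝ) / n ≤ 1 := by
    rw [div_le_one (by exact_mod_cast hn)]
    exact_mod_cast hn
  have hext_zero (ν : ℕ → ProbabilityMeasure X) (hν : ∀ k, IsExtremePointOf Δ (ν k)) :
      Tendsto (fun k => ∫ x, (p i k x - 1 / n) * f x ∂(ν k : Measure X)) ω (𝓝 0) := by
    have hνΔ k := (hν k).1
    obtain ⟨h₁, h₂⟩ := hample i ν hνΔ _ (htrace i ν hνΔ)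
    exact tendsto_integral_mul_sub_of_isExtremePointOf hext ω (fun k x => (hp01 i k x).2) hν
      (by positivity) hn1 (htrace i ν hνΔ) (h₁ (by positivity)) h₂ f
  have hzero : Tendsto (fun k => ∫ x, (p i k x - 1 / n) * f x ∂(μs k : Measure X)) ω (𝓝 0) :=
    tendsto_integral_zero_of_forall_isExtremePointOf hΔclosed
      (fun k => (p i k - ContinuousMap.const X (1 / (n : ℝ))) * f) hext_zero hμs
  have hsq : Tendsto (fun k => ∫ x, (p i k - p i k ^ 2) x ^ 2 ∂(μs k : Measure X)) ω (𝓝 0) :=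
    squeeze_zero (fun k => integral_nonneg fun x => sq_nonneg _)
      (fun k => integral_le_biSup_integral ((p i k - p i k ^ 2) ^ 2) (hμs k)) (hproj i)
  have hlim := (hzero.sub (tendsto_integral_mul_of_tendsto_integral_sq hsq f)).add
    (hL.const_mul (1 / (n : ℝ)))
  rw [sub_zero, zero_add, one_div_mul_eq_div] at hlim
  refine hlim.congr fun k => ?_
  rw [← integral_const_mul, ← integral_sub, ← integral_add]
  · refine integral_congr_ae (Eventually.of_forall fun x => ?_)
    simp only [ContinuousMap.sub_apply, ContinuousMap.pow_apply]
    ring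
  · exact ((p i k - ContinuousMap.const X (1 / (n : ℝ))) * f
      - (p i k - p i k ^ 2) * f).integrable_of_isFiniteMeasure (μs k : Measure X)
  · exact ((1 / (n : ℝ)) • f).integrable_of_isFiniteMeasure (μs k : Measure X)
  · exact ((p i k - ContinuousMap.const X (1 / (n : ℝ))) * f).integrable_of_isFiniteMeasure
      (μs k : Measure X)
  · exact ((p i k - p i k ^ 2) * f).integrable_of_isFiniteMeasure (μs k : Measure X)
end
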